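/- arXiv:2201.05074 — 8 statements merged into one kernel-verified Lean document; each statement's English description precedes it below -/
import Mathlib

section
/- Let t ≥ 3 be an integer such that the negative Pell equation x² − t·y² = −1 has an integer solution. Then the Pell-type equation x² − t·y² = 2 has no integer solution. -/
/-- Modulo squares, solutions of the Pell equation with positive `x` form a group of order at
most two. -/
lemma Pell.Solution₁.isSquare_or_isSquare_or_isSquare_mul {d : ℤ} (h₀ : 0 < d)
    (hd : ¬ IsSquare d) {a b : Pell.Solution₁ d} (ha : 0 < a.x) (hb : 0 < b.x) :
    IsSquare a ∨ IsSquare b ∨ IsSquare (a * b) := by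
  obtain ⟨e, he⟩ := Pell.IsFundamental.exists_of_not_isSquare h₀ hd
  have eq_zpow : ∀ c : Pell.Solution₁ d, 0 < c.x → ∃ n : ℤ, c = e ^ n := by
    intro c hc
    obtain ⟨n, hn | hn⟩ := he.eq_zpow_or_neg_zpow c
    · exact ⟨n, hn⟩
    · have := Pell.Solution₁.x_zpow_pos he.x_pos n
      rw [hn, Pell.Solution₁.x_neg] at hc
      omega
  obtain ⟨m, rfl⟩ := eq_zpow a ha
  obtain ⟨n, rfl⟩ := eq_zpow b hb
  rcases Int.even_or_odd m with hm | hm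
  · exact .inl (hm.isSquare_zpow e)
  rcases Int.even_or_odd n with hn | hn
  · exact .inr (.inl (hn.isSquare_zpow e))
  · rw [← zpow_add]
    exact .inr (.inr ((hm.add_odd hn).isSquare_zpow e))

/-- If `w² = n * a` with `a` the square of a solution of the Pell equation, then `n` has a square
root in `ℤ√d` of the same norm as `w`. -/
lemma Pell.Solution₁.exists_mul_self_eq_of_isSquare {d n : ℤ} {a : Pell.Solution₁ d}
    (ha : IsSquare a) {w : ℤ√d} (hw : w * w = n * (a : ℤ√d)) :
    ∃ g : ℤ√d, g * g = n ∧ g.norm = w.norm := by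
  obtain ⟨c, rfl⟩ := ha
  have hc : (c : ℤ√d) * ((c⁻¹ : Pell.Solution₁ d) : ℤ√d) = 1 :=
    congrArg Subtype.val (mul_inv_cancel c)
  have hcast : ((c * c : Pell.Solution₁ d) : ℤ√d) = (c : ℤ√d) * (c : ℤ√d) := rfl
  refine ⟨((c⁻¹ : Pell.Solution₁ d) : ℤ√d) * w, ?_, ?_⟩
  · rw [hcast] at hw
    linear_combination ((c⁻¹ : Pell.Solution₁ d) : ℤ√d) ^ 2 * hw +
      (n : ℤ√d) * ((c : ℤ√d) * ((c⁻¹ : Pell.Solution₁ d) : ℤ√d) + 1) * hc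
  · rw [Zsqrtd.norm_mul, Zsqrtd.norm_eq_one_iff_mem_unitary.mpr (c⁻¹).2, one_mul]

lemma Zsqrtd.norm_ne_neg_one_of_mul_self_eq_one {d : ℤ} (hd : 1 < d) {g : ℤ√d}
    (hg : g * g = 1) : g.norm ≠ -1 := by
  intro h
  have hre := congrArg Zsqrtd.re hg
  simp only [Zsqrtd.re_mul, Zsqrtd.re_one] at hre
  rw [Zsqrtd.norm_def] at h
  have hunit : d * (g.im * g.im) = 1 := by linarith
  rcases Int.eq_one_or_neg_one_of_mul_eq_one hunit with h | h <;> omega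

lemma Zsqrtd.mul_self_ne_two {d : ℤ} (hd : 2 < d) (g : ℤ√d) : g * g ≠ 2 := by
  intro hg
  have hre := congrArg Zsqrtd.re hg
  simp only [Zsqrtd.re_mul, Zsqrtd.re_ofNat, Nat.cast_ofNat] at hre
  have him : g.im = 0 := by
    by_contra h
    nlinarith [mul_self_nonneg g.re, mul_self_pos.mpr h]
  rw [him] at hre
  have hlt : g.re < 2 := by nlinarith
  have hgt : -2 < g.re := by nlinarith
  interval_cases g.re <;> simp at hre

lemma not_isSquare_of_neg_pell_solvable {d u v : ℤ} (hd : 1 < d)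
    (h : u ^ 2 - d * v ^ 2 = -1) : ¬ IsSquare d := by
  rintro ⟨s, rfl⟩
  have hprod : (s * v - u) * (s * v + u) = 1 := by linear_combination -h
  have hsv : s * v = 1 ∨ s * v = -1 := by
    rcases Int.eq_one_or_neg_one_of_mul_eq_one' hprod with h | h <;> omega
  rcases hsv with h | h
  · rcases Int.eq_one_or_neg_one_of_mul_eq_one h with rfl | rfl <;> norm_num at hd
  · rcases Int.eq_one_or_neg_one_of_mul_eq_neg_one h with rfl | rfl <;> norm_num at hd

/-- If `t ≥ 3` and the negative Pell equation `x² − t·y² = −1` has an integer solution,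
then the Pell-type equation `x² − t·y² = 2` has no integer solution. -/
theorem pell_two_unsolvable_of_neg_pell_solvable (t : ℤ) (ht : 3 ≤ t)
    (hsol : ∃ x y : ℤ, x ^ 2 - t * y ^ 2 = -1) :
    ¬ ∃ x y : ℤ, x ^ 2 - t * y ^ 2 = 2 := by
  rintro ⟨x, y, hxy⟩
  obtain ⟨u, v, huv⟩ := hsol
  have hsq := not_isSquare_of_neg_pell_solvable (by omega) huv
  -- `a = (u + v√t)²` and `b = (x + y√t)² / 2`
  let a : Pell.Solution₁ t := .mk (u ^ 2 + t * v ^ 2) (2 * u * v) (by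
    linear_combination (u ^ 2 - t * v ^ 2 - 1) * huv)
  let b : Pell.Solution₁ t := .mk (1 + t * y ^ 2) (x * y) (by
    linear_combination (-t * y ^ 2) * hxy)
  have ha : (⟨u, v⟩ : ℤ√t) * ⟨u, v⟩ = (1 : ℤ) * (a : ℤ√t) := by
    ext <;> simp [a] <;> ring
  have hb : (⟨x, y⟩ : ℤ√t) * ⟨x, y⟩ = (2 : ℤ) * (b : ℤ√t) := by
    ext <;> simp [b]
    · linear_combination hxy
    · ring
  have hax : 0 < a.x := by
    change 0 < u ^ 2 + t * v ^ 2
    nlinarith [sq_nonneg u]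
  have hbx : 0 < b.x := by
    change 0 < 1 + t * y ^ 2
    positivity
  rcases Pell.Solution₁.isSquare_or_isSquare_or_isSquare_mul (by omega) hsq hax hbx with h | h | h
  · obtain ⟨g, hg, hnorm⟩ := Pell.Solution₁.exists_mul_self_eq_of_isSquare h ha
    refine Zsqrtd.norm_ne_neg_one_of_mul_self_eq_one (g := g) (by omega : 1 < t) (by simpa using hg) ?_
    rw [hnorm, Zsqrtd.norm_def]
    linear_combination huv
  · obtain ⟨g, hg, -⟩ := Pell.Solution₁.exists_mul_self_eq_of_isSquare h hb
    exact Zsqrtd.mul_self_ne_two (by omega) g (by simpa using hg)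
  · have hab : ((⟨u, v⟩ : ℤ√t) * ⟨x, y⟩) * (⟨u, v⟩ * ⟨x, y⟩) =
        (2 : ℤ) * ((a * b : Pell.Solution₁ t) : ℤ√t) := by
      have hcast : ((a * b : Pell.Solution₁ t) : ℤ√t) = (a : ℤ√t) * (b : ℤ√t) := rfl
      rw [mul_mul_mul_comm, ha, hb, hcast]
      push_cast
      ring
    obtain ⟨g, hg, -⟩ := Pell.Solution₁.exists_mul_self_eq_of_isSquare h hab
    exact Zsqrtd.mul_self_ne_two (by omega) g (by simpa using hg)
end

section
/- Let t, a, b be positive integers with a² − t·b² = −1, and set c := a² + t·b², d := 2·a·b. Then there exist no rational numbers x, y, z, w satisfying simultaneously: (1) t·x − z + 5·w = 0; (2) 3·t²·x² − t·y² + 3·z² + 23·w² − 2·t·x·z + 10·t·x·w − 10·z·w = 48; (3) x − c²·x − c·d·y − d²·z = 0; (4) (t + 2·t²·b²)·x + 2·a·b·t·y + (2·a² − 1)·z + 5·w = 2. -/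
/-- The quadratic `12 w² + 5 w - 11` has discriminant `553 = 7 * 79`, hence no rational root. -/
lemma twelve_sq_add_five_sub_eleven_ne_zero (w : ℚ) : 12 * w ^ 2 + 5 * w - 11 ≠ 0 := by
  intro h
  have hsq : IsSquare ((553 : ℕ) : ℚ) := ⟨24 * w + 5, by push_cast; linear_combination -48 * h⟩
  rw [Rat.isSquare_natCast_iff] at hsq
  obtain ⟨n, hn⟩ := hsq
  have hlt : n < 24 := by nlinarith
  interval_cases n <;> omega

/-- Case `r = 2` of the system in the proof of Theorem 5.3: no rational solutions. -/
theorem no_rational_solution_r_eq_two (t a b : ℤ)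
    (ht : 0 < t) (ha : 0 < a) (hb : 0 < b)
    (hPell : a ^ 2 - t * b ^ 2 = -1) :
    ¬ ∃ x y z w : ℚ,
      (t : ℚ) * x - z + 5 * w = 0 ∧
      3 * (t : ℚ) ^ 2 * x ^ 2 - (t : ℚ) * y ^ 2 + 3 * z ^ 2 + 23 * w ^ 2
        - 2 * (t : ℚ) * x * z + 10 * (t : ℚ) * x * w - 10 * z * w = 48 ∧
      x - ((a : ℚ) ^ 2 + (t : ℚ) * (b : ℚ) ^ 2) ^ 2 * x
        - ((a : ℚ) ^ 2 + (t : ℚ) * (b : ℚ) ^ 2) * (2 * (a : ℚ) * (b : ℚ)) * y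
        - (2 * (a : ℚ) * (b : ℚ)) ^ 2 * z = 0 ∧
      ((t : ℚ) + 2 * (t : ℚ) ^ 2 * (b : ℚ) ^ 2) * x + 2 * (a : ℚ) * (b : ℚ) * (t : ℚ) * y
        + (2 * (a : ℚ) ^ 2 - 1) * z + 5 * w = 2 := by
  rintro ⟨x, y, z, w, h1, h2, h3, h4⟩
  have hP : (a : ℚ) ^ 2 - t * b ^ 2 = -1 := by exact_mod_cast hPell
  have ha' : (0 : ℚ) < a := by exact_mod_cast ha
  have hb' : (0 : ℚ) < b := by exact_mod_cast hb
  obtain rfl : z = t * x + 5 * w := by linear_combination -h1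
  have hc : (2 * (a : ℚ) ^ 2 + 1) ≠ 0 := by positivity
  have hd : (2 * (a : ℚ) * b) ≠ 0 := by positivity
  have hs : (t : ℚ) * b ^ 2 = a ^ 2 + 1 := by linear_combination -hP
  rw [hs] at h3
  have hy : (2 * (a : ℚ) ^ 2 + 1) * y = -(2 * a * b) * (2 * (t * x) + 5 * w) := by
    apply mul_left_cancel₀ hd
    linear_combination -h3 + 4 * a ^ 2 * x * hs
  have hX : (t : ℚ) * x = 2 * a ^ 2 + 1 + 5 * w * a ^ 2 := by
    linear_combination (2 * (a : ℚ) ^ 2 + 1) / 2 * h4 - a * b * t * hy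
      + (2 * a ^ 2 * (2 * (t * x) + 5 * w) - (2 * a ^ 2 + 1) * (t * x)) * hs
  have hy' : y = -(2 * a * b) * (2 + 5 * w) := by
    apply mul_left_cancel₀ hc
    linear_combination hy - 2 * (2 * a * b) * hX
  refine twelve_sq_add_five_sub_eleven_ne_zero w ?_
  have h2' : (2 * ((t : ℚ) * x) + 5 * w) ^ 2 + 23 * w ^ 2 - t * y ^ 2 = 48 := by
    linear_combination h2
  rw [hX, hy'] at h2'
  linear_combination h2' / 4 + a ^ 2 * (2 + 5 * w) ^ 2 * hs
end

section
/- Let t, a, b be positive integers with a² − t·b² = −1, and set c := a² + t·b², d := 2·a·b. Then there exist no rational numbers x, y, z, w satisfying simultaneously: (1) t·x − z + 5·w = 0; (2) 3·t²·x² − t·y² + 3·z² + 23·w² − 2·t·x·z + 10·t·x·w − 10·z·w = 48; (3) x − c²·x − c·d·y − d²·z = 0; (4) (t + 2·t²·b²)·x + 2·a·b·t·y + (2·a² − 1)·z + 5·w = 6. -/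
/-- Case `r = 6` of the system in the proof of Theorem 5.3: no rational solutions. -/
theorem no_rational_solution_r_eq_six (t a b : ℤ)
    (ht : 0 < t) (ha : 0 < a) (hb : 0 < b)
    (hPell : a ^ 2 - t * b ^ 2 = -1) :
    ¬ ∃ x y z w : ℚ,
      (t : ℚ) * x - z + 5 * w = 0 ∧
      3 * (t : ℚ) ^ 2 * x ^ 2 - (t : ℚ) * y ^ 2 + 3 * z ^ 2 + 23 * w ^ 2
        - 2 * (t : ℚ) * x * z + 10 * (t : ℚ) * x * w - 10 * z * w = 48 ∧
      x - ((a : ℚ) ^ 2 + (t : ℚ) * (b : ℚ) ^ 2) ^ 2 * x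
        - ((a : ℚ) ^ 2 + (t : ℚ) * (b : ℚ) ^ 2) * (2 * (a : ℚ) * (b : ℚ)) * y
        - (2 * (a : ℚ) * (b : ℚ)) ^ 2 * z = 0 ∧
      ((t : ℚ) + 2 * (t : ℚ) ^ 2 * (b : ℚ) ^ 2) * x + 2 * (a : ℚ) * (b : ℚ) * (t : ℚ) * y
        + (2 * (a : ℚ) ^ 2 - 1) * z + 5 * w = 6 := by
  rintro ⟨x, y, z, w, h1, h2, h3, h4⟩
  have hP : (a : ℚ) ^ 2 - t * (b : ℚ) ^ 2 = -1 := by exact_mod_cast hPell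
  have ha' : (a : ℚ) ≠ 0 := by exact_mod_cast ha.ne'
  have hb' : (b : ℚ) ≠ 0 := by exact_mod_cast hb.ne'
  obtain ⟨c, hc⟩ : ∃ c : ℚ, c = (a : ℚ) ^ 2 + t * (b : ℚ) ^ 2 := ⟨_, rfl⟩
  obtain ⟨d, hd⟩ : ∃ d : ℚ, d = 2 * (a : ℚ) * b := ⟨_, rfl⟩
  have hd0 : d ≠ 0 := by rw [hd]; positivity
  have hcd : c ^ 2 - t * d ^ 2 = 1 := by
    rw [hc, hd]
    linear_combination ((a : ℚ) ^ 2 - t * (b : ℚ) ^ 2 - 1) * hP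
  rw [← hc, ← hd] at h3
  have hy : d * (t * x + z) + c * y = 0 := by
    apply mul_left_cancel₀ hd0
    linear_combination -h3 - x * hcd
  -- `u` is the coordinate of the class along the invariant direction of the involution.
  obtain ⟨u, hu⟩ : ∃ u : ℚ, u = c * (t * x + z) + t * d * y := ⟨_, rfl⟩
  have hsu : t * x + z = c * u := by
    rw [hu]
    linear_combination -(t * x + z) * hcd - t * d * hy
  have hyu : y = -(d * u) := by
    rw [hu]
    linear_combination -y * hcd + c * hy
  have huw : u = 6 + 5 * w := by
    rw [hu, hc, hd]
    linear_combination h4 - 2 * h1 + (t * x - z) * hP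
  have hquad : u ^ 2 + 23 * w ^ 2 = 48 := by
    have hnorm : (t * x + z) ^ 2 - t * y ^ 2 = u ^ 2 := by
      rw [hsu, hyu]
      linear_combination u ^ 2 * hcd
    linear_combination h2 - hnorm - 2 * (t * x - z) * h1
  have hsq : (8 * w + 5) ^ 2 = 41 := by
    rw [huw] at hquad
    linear_combination 4 / 3 * hquad
  have hns : ¬ IsSquare ((41 : ℕ) : ℚ) := by
    rw [Rat.isSquare_natCast_iff]
    rintro ⟨n, hn⟩
    have : n < 7 := by nlinarith
    interval_cases n <;> omega
  exact hns ⟨8 * w + 5, by push_cast; linear_combination -hsq⟩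
end

section
/- Let t, a, b be positive integers with a² − t·b² = −1, and set c := a² + t·b², d := 2·a·b. If rational numbers x, y, z, w satisfy simultaneously: (1) t·x − z + 5·w = 0; (2) 3·t²·x² − t·y² + 3·z² + 23·w² − 2·t·x·z + 10·t·x·w − 10·z·w = 48; (3) x − c²·x − c·d·y − d²·z = 0; (4) (t + 2·t²·b²)·x + 2·a·b·t·y + (2·a² − 1)·z + 5·w = 10, then w = −1 or w = −13/12. -/
/-- Case `r = 10` of the system in the proof of Theorem 5.3: any rational solution
has `w = −1` or `w = −13/12`. -/
theorem w_values_r_eq_ten (t a b : ℤ)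
    (ht : 0 < t) (ha : 0 < a) (hb : 0 < b)
    (hPell : a ^ 2 - t * b ^ 2 = -1)
    (x y z w : ℚ)
    (h1 : (t : ℚ) * x - z + 5 * w = 0)
    (h2 : 3 * (t : ℚ) ^ 2 * x ^ 2 - (t : ℚ) * y ^ 2 + 3 * z ^ 2 + 23 * w ^ 2
        - 2 * (t : ℚ) * x * z + 10 * (t : ℚ) * x * w - 10 * z * w = 48)
    (h3 : x - ((a : ℚ) ^ 2 + (t : ℚ) * (b : ℚ) ^ 2) ^ 2 * x
        - ((a : ℚ) ^ 2 + (t : ℚ) * (b : ℚ) ^ 2) * (2 * (a : ℚ) * (b : ℚ)) * y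
        - (2 * (a : ℚ) * (b : ℚ)) ^ 2 * z = 0)
    (h4 : ((t : ℚ) + 2 * (t : ℚ) ^ 2 * (b : ℚ) ^ 2) * x + 2 * (a : ℚ) * (b : ℚ) * (t : ℚ) * y
        + (2 * (a : ℚ) ^ 2 - 1) * z + 5 * w = 10) :
    w = -1 ∨ w = -13 / 12 := by
  have hP : (t : ℚ) * (b : ℚ) ^ 2 = (a : ℚ) ^ 2 + 1 := by
    have h : ((a ^ 2 - t * b ^ 2 : ℤ) : ℚ) = ((-1 : ℤ) : ℚ) := by rw [hPell]
    push_cast at h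
    linarith
  have ha' : (0 : ℚ) < a := by exact_mod_cast ha
  have hb' : (0 : ℚ) < b := by exact_mod_cast hb
  obtain ⟨c, hc⟩ : ∃ c : ℚ, c = 2 * (a : ℚ) ^ 2 + 1 := ⟨_, rfl⟩
  obtain ⟨d, hd⟩ : ∃ d : ℚ, d = 2 * (a : ℚ) * b := ⟨_, rfl⟩
  have hc0 : c ≠ 0 := by rw [hc]; positivity
  have hd0 : d ≠ 0 := by rw [hd]; positivity
  have hcd : t * d ^ 2 = c ^ 2 - 1 := by
    rw [hc, hd]
    linear_combination 4 * (a : ℚ) ^ 2 * hP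
  have hsum : (a : ℚ) ^ 2 + t * (b : ℚ) ^ 2 = c := by rw [hc, hP]; ring
  rw [hsum, ← hd] at h3
  have hz : z = t * x + 5 * w := by linarith
  subst hz
  -- invariance under the involution, after cancelling `d`
  have hinv : c * y = -d * (2 * (t * x) + 5 * w) := by
    apply mul_left_cancel₀ hd0
    linear_combination -h3 + x * hcd
  have hdeg : 2 * c * (t * x) + t * d * y + 5 * (c - 1) * w = 10 := by
    rw [hc, hd]
    linear_combination h4 - 2 * t * x * hP
  have hx : 2 * (t * x) + 5 * w = 5 * c * (2 + w) := by
    linear_combination c * hdeg - t * d * hinv + (2 * (t * x) + 5 * w) * hcd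
  have hy : y = -5 * d * (2 + w) := by
    apply mul_left_cancel₀ hc0
    linear_combination hinv - d * hx
  have hw : (w + 1) * (12 * w + 13) = 0 := by
    have hx2 : (2 * (t * x) + 5 * w) ^ 2 = (5 * c * (2 + w)) ^ 2 := by rw [hx]
    rw [hy] at h2
    linear_combination (1 / 4) * h2 - (1 / 4) * hx2 + (25 / 4) * (2 + w) ^ 2 * hcd
  rcases mul_eq_zero.mp hw with h | h
  · left; linarith
  · right; linarith
end

section
/- Let t, a, b be positive integers with a² − t·b² = −1, and set c := a² + t·b², d := 2·a·b. Then rational numbers x, y, z, w satisfy simultaneously (1) t·x − z + 5·w = 0; (2) 3·t²·x² − t·y² + 3·z² + 23·w² − 2·t·x·z + 10·t·x·w − 10·z·w = 48; (3) x − c²·x − c·d·y − d²·z = 0; (4) (t + 2·t²·b²)·x + 2·a·b·t·y + (2·a² − 1)·z + 5·w = 10 if and only if (x, y, z, w) = (5·b², −10·a·b, 5·a², −1) or (x, y, z, w) = ((55·a² + 60)/(12·t), −55·a·b/6, (55·a² − 5)/12, −13/12). -/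
/-- Given `t * b ^ 2 = a ^ 2 + 1`, the solutions of the system lie on a line parametrised by `w`,
on which the quadratic equation becomes `(w + 1) * (12 * w + 13) = 0`. -/
lemma system_iff_parametrization {t a b : ℚ} (ha : 0 < a) (hb : 0 < b)
    (hP : t * b ^ 2 = a ^ 2 + 1) (x y z w : ℚ) :
    (t * x - z + 5 * w = 0 ∧
      3 * t ^ 2 * x ^ 2 - t * y ^ 2 + 3 * z ^ 2 + 23 * w ^ 2
        - 2 * t * x * z + 10 * t * x * w - 10 * z * w = 48 ∧
      x - (a ^ 2 + t * b ^ 2) ^ 2 * x - (a ^ 2 + t * b ^ 2) * (2 * a * b) * y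
        - (2 * a * b) ^ 2 * z = 0 ∧
      (t + 2 * t ^ 2 * b ^ 2) * x + 2 * a * b * t * y + (2 * a ^ 2 - 1) * z + 5 * w = 10) ↔
    (t * x = 5 * a ^ 2 * w + 10 * a ^ 2 + 5 ∧ y = -(2 * a * b) * (5 * w + 10) ∧
      z = t * x + 5 * w ∧ (w + 1) * (12 * w + 13) = 0) := by
  have hc0 : 2 * a ^ 2 + 1 ≠ 0 := by positivity
  have hd0 : 2 * a * b ≠ 0 := by positivity
  constructor
  · rintro ⟨h1, h2, h3, h4⟩
    obtain rfl : z = t * x + 5 * w := by linarith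
    -- The invariance equation, divided by `2 * a * b`.
    have hinv : (2 * a ^ 2 + 1) * y = -(2 * a * b) * (2 * (t * x) + 5 * w) := by
      apply mul_left_cancel₀ hd0
      rw [hP] at h3
      linear_combination -h3 + 4 * a ^ 2 * x * hP
    have hx : t * x = 5 * a ^ 2 * w + 10 * a ^ 2 + 5 := by
      linear_combination (2 * a ^ 2 + 1) / 2 * h4 - a * b * t * hinv
        + (2 * a ^ 2 * (2 * (t * x) + 5 * w) - (2 * a ^ 2 + 1) * t * x) * hP
    have hy : y = -(2 * a * b) * (5 * w + 10) := by
      apply mul_left_cancel₀ hc0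
      rw [hinv, hx]
      ring
    refine ⟨hx, hy, rfl, ?_⟩
    have h2' : 4 * (t * x) ^ 2 + 20 * (t * x) * w + 48 * w ^ 2 - t * y ^ 2 = 48 := by
      linear_combination h2
    rw [hx, hy] at h2'
    linear_combination h2' / 4 + 25 * a ^ 2 * (w + 2) ^ 2 * hP
  · rintro ⟨hx, rfl, rfl, hw⟩
    refine ⟨by ring, ?_, ?_, ?_⟩
    · have h : 4 * (t * x) ^ 2 + 20 * (t * x) * w + 48 * w ^ 2
          - t * (-(2 * a * b) * (5 * w + 10)) ^ 2 = 48 := by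
        rw [hx]
        linear_combination 4 * hw - 100 * a ^ 2 * (w + 2) ^ 2 * hP
      linear_combination h
    · rw [hP]
      linear_combination 4 * a ^ 2 * x * hP - 8 * a ^ 2 * b ^ 2 * hx
    · linear_combination (4 * a ^ 2 + 2) * hx + (2 * t * x - 20 * a ^ 2 * (w + 2)) * hP

/-- Complete classification of the rational solutions of the system in the proof of
Theorem 5.3 in the case `r = 10`. -/
theorem rational_solutions_r_eq_ten (t a b : ℤ)
    (ht : 0 < t) (ha : 0 < a) (hb : 0 < b)
    (hPell : a ^ 2 - t * b ^ 2 = -1) :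
    ∀ x y z w : ℚ,
      ((t : ℚ) * x - z + 5 * w = 0 ∧
       3 * (t : ℚ) ^ 2 * x ^ 2 - (t : ℚ) * y ^ 2 + 3 * z ^ 2 + 23 * w ^ 2
         - 2 * (t : ℚ) * x * z + 10 * (t : ℚ) * x * w - 10 * z * w = 48 ∧
       x - ((a : ℚ) ^ 2 + (t : ℚ) * (b : ℚ) ^ 2) ^ 2 * x
         - ((a : ℚ) ^ 2 + (t : ℚ) * (b : ℚ) ^ 2) * (2 * (a : ℚ) * (b : ℚ)) * y
         - (2 * (a : ℚ) * (b : ℚ)) ^ 2 * z = 0 ∧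
       ((t : ℚ) + 2 * (t : ℚ) ^ 2 * (b : ℚ) ^ 2) * x + 2 * (a : ℚ) * (b : ℚ) * (t : ℚ) * y
         + (2 * (a : ℚ) ^ 2 - 1) * z + 5 * w = 10)
      ↔
      ((x = 5 * (b : ℚ) ^ 2 ∧ y = -10 * (a : ℚ) * (b : ℚ) ∧ z = 5 * (a : ℚ) ^ 2 ∧ w = -1) ∨
       (x = (55 * (a : ℚ) ^ 2 + 60) / (12 * (t : ℚ)) ∧
        y = -(55 * (a : ℚ) * (b : ℚ)) / 6 ∧
        z = (55 * (a : ℚ) ^ 2 - 5) / 12 ∧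
        w = -13 / 12)) := by
  intro x y z w
  have hP : (t : ℚ) * (b : ℚ) ^ 2 = (a : ℚ) ^ 2 + 1 := by
    have h : (a : ℚ) ^ 2 - t * (b : ℚ) ^ 2 = -1 := by exact_mod_cast hPell
    linarith
  have ht0 : (t : ℚ) ≠ 0 := by exact_mod_cast ht.ne'
  rw [system_iff_parametrization (by exact_mod_cast ha) (by exact_mod_cast hb) hP]
  constructor
  · rintro ⟨hx, hy, hz, hw⟩
    rcases mul_eq_zero.mp hw with hw | hw
    · obtain rfl : w = -1 := by linarith
      refine .inl ⟨?_, ?_, ?_, rfl⟩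
      · apply mul_left_cancel₀ ht0
        linear_combination hx - 5 * hP
      · linear_combination hy
      · linear_combination hz + hx
    · obtain rfl : w = -13 / 12 := by linarith
      refine .inr ⟨?_, ?_, ?_, rfl⟩
      · rw [eq_div_iff (by simpa using ht0)]
        linear_combination 12 * hx
      · linear_combination hy
      · linear_combination hz + hx
  · rintro (⟨rfl, rfl, rfl, rfl⟩ | ⟨hx, rfl, rfl, rfl⟩)
    · refine ⟨?_, by ring, ?_, by norm_num⟩
      · linear_combination 5 * hP
      · linear_combination -5 * hP
    · rw [eq_div_iff (by simpa using ht0)] at hx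
      refine ⟨?_, by ring, ?_, by norm_num⟩
      · linear_combination hx / 12
      · linear_combination -hx / 12
end

section
/- Let t, a, b be positive integers with a² − t·b² = −1, and set c := a² + t·b², d := 2·a·b. If rational numbers x, y, z, w satisfy simultaneously (1) t·x − z + 5·w = 0; (2) 3·t²·x² − t·y² + 3·z² + 23·w² − 2·t·x·z + 10·t·x·w − 10·z·w = 48; (3) x − c²·x − c·d·y − d²·z = 0; (4) (t + 2·t²·b²)·x + 2·a·b·t·y + (2·a² − 1)·z + 5·w = 10, and if moreover w is an integer, then (x, y, z, w) = (5·b², −10·a·b, 5·a², −1). Conversely, the quadruple (5·b², −10·a·b, 5·a², −1) satisfies all four equations. -/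
/-- In the case `r = 10` of the system in the proof of Theorem 5.3, if moreover `w` is an
integer, then `(x, y, z, w) = (5b², −10ab, 5a², −1)`; conversely this quadruple satisfies
all four equations. -/
theorem integral_solution_r_eq_ten (t a b : ℤ)
    (ht : 0 < t) (ha : 0 < a) (hb : 0 < b)
    (hPell : a ^ 2 - t * b ^ 2 = -1) :
    (∀ x y z w : ℚ,
      (t : ℚ) * x - z + 5 * w = 0 →
      3 * (t : ℚ) ^ 2 * x ^ 2 - (t : ℚ) * y ^ 2 + 3 * z ^ 2 + 23 * w ^ 2
        - 2 * (t : ℚ) * x * z + 10 * (t : ℚ) * x * w - 10 * z * w = 48 →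
      x - ((a : ℚ) ^ 2 + (t : ℚ) * (b : ℚ) ^ 2) ^ 2 * x
        - ((a : ℚ) ^ 2 + (t : ℚ) * (b : ℚ) ^ 2) * (2 * (a : ℚ) * (b : ℚ)) * y
        - (2 * (a : ℚ) * (b : ℚ)) ^ 2 * z = 0 →
      ((t : ℚ) + 2 * (t : ℚ) ^ 2 * (b : ℚ) ^ 2) * x + 2 * (a : ℚ) * (b : ℚ) * (t : ℚ) * y
        + (2 * (a : ℚ) ^ 2 - 1) * z + 5 * w = 10 →
      (∃ n : ℤ, w = (n : ℚ)) →
      (x = 5 * (b : ℚ) ^ 2 ∧ y = -10 * (a : ℚ) * (b : ℚ) ∧ z = 5 * (a : ℚ) ^ 2 ∧ w = -1))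
    ∧
    ((t : ℚ) * (5 * (b : ℚ) ^ 2) - 5 * (a : ℚ) ^ 2 + 5 * (-1 : ℚ) = 0 ∧
     3 * (t : ℚ) ^ 2 * (5 * (b : ℚ) ^ 2) ^ 2 - (t : ℚ) * (-10 * (a : ℚ) * (b : ℚ)) ^ 2
       + 3 * (5 * (a : ℚ) ^ 2) ^ 2 + 23 * (-1 : ℚ) ^ 2
       - 2 * (t : ℚ) * (5 * (b : ℚ) ^ 2) * (5 * (a : ℚ) ^ 2)
       + 10 * (t : ℚ) * (5 * (b : ℚ) ^ 2) * (-1 : ℚ)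
       - 10 * (5 * (a : ℚ) ^ 2) * (-1 : ℚ) = 48 ∧
     (5 * (b : ℚ) ^ 2) - ((a : ℚ) ^ 2 + (t : ℚ) * (b : ℚ) ^ 2) ^ 2 * (5 * (b : ℚ) ^ 2)
       - ((a : ℚ) ^ 2 + (t : ℚ) * (b : ℚ) ^ 2) * (2 * (a : ℚ) * (b : ℚ))
           * (-10 * (a : ℚ) * (b : ℚ))
       - (2 * (a : ℚ) * (b : ℚ)) ^ 2 * (5 * (a : ℚ) ^ 2) = 0 ∧
     ((t : ℚ) + 2 * (t : ℚ) ^ 2 * (b : ℚ) ^ 2) * (5 * (b : ℚ) ^ 2)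
       + 2 * (a : ℚ) * (b : ℚ) * (t : ℚ) * (-10 * (a : ℚ) * (b : ℚ))
       + (2 * (a : ℚ) ^ 2 - 1) * (5 * (a : ℚ) ^ 2) + 5 * (-1 : ℚ) = 10) := by
  have hA : (a : ℚ) ^ 2 = (t : ℚ) * (b : ℚ) ^ 2 - 1 := by
    have h : ((a ^ 2 - t * b ^ 2 : ℤ) : ℚ) = ((-1 : ℤ) : ℚ) := congrArg _ hPell
    push_cast at h
    linarith
  have ht' : (t : ℚ) ≠ 0 := by exact_mod_cast ht.ne'
  have ha' : (a : ℚ) ≠ 0 := by exact_mod_cast ha.ne'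
  have hb' : (b : ℚ) ≠ 0 := by exact_mod_cast hb.ne'
  generalize (t : ℚ) = T at *
  generalize (a : ℚ) = p at *
  generalize (b : ℚ) = q at *
  refine ⟨?_, by grind, by grind, by grind, by grind⟩
  rintro x y z w h1 h2 h3 h4 ⟨n, hn⟩
  have hz : z = T * x + 5 * w := by linarith
  subst hz
  -- The invariance equation is `-d` times a linear relation, with `d = 2pq ≠ 0`.
  have hinv : 4 * p * q * T * x + (2 * p ^ 2 + 1) * y + 10 * p * q * w = 0 := by
    have h : (2 * p * q) * (4 * p * q * T * x + (2 * p ^ 2 + 1) * y + 10 * p * q * w) = 0 := by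
      linear_combination -h3 + ((1 - p ^ 2 + T * q ^ 2) * x + 2 * p * q * y) * hA
    exact (mul_eq_zero.mp h).resolve_left (by positivity)
  have hx : T * x = 5 * (2 * p ^ 2 + 1) + 5 * p ^ 2 * w := by grind
  have hy : y = -20 * p * q - 10 * p * q * w := by grind
  have hw : (w + 1) * (12 * w + 13) = 0 := by
    have hy2 : T * y ^ 2 = 100 * p ^ 2 * (p ^ 2 + 1) * (2 + w) ^ 2 := by
      rw [hy]; grind
    have hquad : 4 * (T * x) ^ 2 + 20 * (T * x) * w + 48 * w ^ 2 - T * y ^ 2 = 48 := by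
      linear_combination h2
    rw [hy2, hx] at hquad
    linear_combination hquad / 4
  have hw1 : w = -1 := by
    rcases mul_eq_zero.mp hw with h | h
    · linarith
    · rw [hn] at h
      have : 12 * n + 13 = 0 := by exact_mod_cast h
      omega
  subst hw1
  have hx' : x = 5 * q ^ 2 := mul_left_cancel₀ ht' (by linarith)
  exact ⟨hx', by linarith, by linarith, rfl⟩
end

section
/- The integer quadruples (x, y, z, w) satisfying simultaneously 0 ≤ 12·x + 6·y + z + 10·w ≤ 10, 0 ≤ 4·x + 2·y + z + 10·w ≤ 2, 0 < 40·x + 12·y + 3·z + 20·w < 12, and 16·x + 2·y + z = 0 are exactly (x, y, z, w) = (0, 1, −2, 0) and (x, y, z, w) = (−1, 3, 10, −1). -/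
/-- The integer solutions of the Diophantine system arising in the proof of
Theorem 6.4(i) (case `t = 2`) are exactly `(0, 1, −2, 0)` and `(−1, 3, 10, −1)`. -/
theorem t_eq_two_system_solutions :
    ∀ x y z w : ℤ,
      (0 ≤ 12 * x + 6 * y + z + 10 * w ∧ 12 * x + 6 * y + z + 10 * w ≤ 10 ∧
       0 ≤ 4 * x + 2 * y + z + 10 * w ∧ 4 * x + 2 * y + z + 10 * w ≤ 2 ∧
       0 < 40 * x + 12 * y + 3 * z + 20 * w ∧ 40 * x + 12 * y + 3 * z + 20 * w < 12 ∧
       16 * x + 2 * y + z = 0)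
      ↔
      ((x, y, z, w) = (0, 1, -2, 0) ∨ (x, y, z, w) = (-1, 3, 10, -1)) := by
  intro x y z w
  simp only [Prod.mk.injEq]
  constructor
  · rintro ⟨h₁, h₂, h₃, h₄, h₅, h₆, h₇⟩
    have hx_lower : -4 < x := by linarith
    have hx_upper : x < 3 := by linarith
    interval_cases x <;> omega
  · omega
end

section
/- Let t, a, b be positive integers with t ≥ 10, a ≥ 3 and a² − t·b² = −1, such that (a, b) is the minimal solution of the negative Pell equation x² − t·y² = −1 (i.e. every pair of positive integers (a', b') with a'² − t·b'² = −1 satisfies a ≤ a'), and assume that the Pell-type equation x² − 4t·y² = 5 has no integer solutions. Set c := a² + t·b², d := 2·a·b. Then there exist no integers x, y, z, w satisfying simultaneously: 0 ≤ 6·t·x + 3·t·y + z + 10·w ≤ 6·t·b² − 2·a², 0 ≤ 2·t·x + t·y + z + 10·w ≤ 2, 0 < (4·t + 8·t²·b²)·x + (2·t + 4·t²·b² − 4·a·b·t)·y + (1 + t·b²)·z + 20·w < 12, and 8·t·d·x + 4·(t·d − c)·y + d·z = 0. -/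
/-- For a solution of `a² − t·b² = −1`, the product `a·b` is coprime to `2·a² + 1`. -/
lemma isCoprime_mul_of_negPell {t a b : ℤ} (h : a ^ 2 - t * b ^ 2 = -1) :
    IsCoprime (a * b) (2 * a ^ 2 + 1) := by
  refine IsCoprime.mul_left ⟨-2 * a, 1, by ring⟩ ⟨2 * t * b, -1, ?_⟩
  linear_combination (-2) * h

/-- In a solution of `a² − t·b² = −1`, the number `b` is odd. -/
lemma odd_of_negPell {t a b : ℤ} (h : a ^ 2 - t * b ^ 2 = -1) : Odd b := by
  by_contra hb
  obtain ⟨r, rfl⟩ := Int.not_odd_iff_even.1 hb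
  have h4 : a ^ 2 = 4 * (t * r ^ 2) - 1 := by linear_combination h
  rcases Int.even_or_odd' a with ⟨s, rfl | rfl⟩ <;> ring_nf at h4 <;> omega

/-- If `(a, b)` is the minimal solution of `x² − t·y² = −1` with `t ≥ 10` and `a ≥ 3`, then `0` is
the only multiple `t * j` of `t` of absolute value at most `12`, unless `(t, a, b) = (10, 3, 1)`. -/
lemma eq_zero_or_of_negPell_minimal {t a b j : ℤ} (ht : 10 ≤ t) (ha3 : 3 ≤ a) (hb : 0 < b)
    (hPell : a ^ 2 - t * b ^ 2 = -1)
    (hmin : ∀ a' b' : ℤ, 0 < a' → 0 < b' → a' ^ 2 - t * b' ^ 2 = -1 → a ≤ a')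
    (hlo : -12 ≤ t * j) (hhi : t * j ≤ 12) : j = 0 ∨ t = 10 ∧ a = 3 ∧ b = 1 := by
  by_cases hj : j = 0
  · exact Or.inl hj
  right
  have ht12 : t ≤ 12 := by
    rcases lt_or_gt_of_ne hj with h | h <;> nlinarith
  have ht10 : t = 10 := by
    interval_cases t
    · rfl
    · have h11 : (a ^ 2 + 1) % 11 = 0 := by omega
      have : a % 11 = 0 ∨ a % 11 = 1 ∨ a % 11 = 2 ∨ a % 11 = 3 ∨ a % 11 = 4 ∨ a % 11 = 5 ∨
        a % 11 = 6 ∨ a % 11 = 7 ∨ a % 11 = 8 ∨ a % 11 = 9 ∨ a % 11 = 10 := by omega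
      rcases this with h | h | h | h | h | h | h | h | h | h | h <;>
        simp [pow_two, Int.add_emod, Int.mul_emod, h] at h11
    · have h3 : (a ^ 2 + 1) % 3 = 0 := by omega
      have : a % 3 = 0 ∨ a % 3 = 1 ∨ a % 3 = 2 := by omega
      rcases this with h | h | h <;> simp [pow_two, Int.add_emod, Int.mul_emod, h] at h3
  subst ht10
  have ha : a = 3 := le_antisymm (hmin 3 1 (by norm_num) (by norm_num) (by norm_num)) ha3
  subst ha
  exact ⟨rfl, rfl, by nlinarith⟩

/-- The computational core of the irreducibility property (Theorem 6.4(ii)): for `t ≥ 10`,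
`(a, b)` the minimal solution of the negative Pell equation `x² − t·y² = −1` with `a ≥ 3`,
assuming `x² − 4t·y² = 5` has no integer solutions, the displayed Diophantine system has no
integer solutions, where `c = a² + t·b²` and `d = 2·a·b`. -/
theorem irreducibility_system_no_integer_solutions (t a b : ℤ)
    (ht : 10 ≤ t) (ha3 : 3 ≤ a) (ha : 0 < a) (hb : 0 < b)
    (hPell : a ^ 2 - t * b ^ 2 = -1)
    (hmin : ∀ a' b' : ℤ, 0 < a' → 0 < b' → a' ^ 2 - t * b' ^ 2 = -1 → a ≤ a')
    (h4t5 : ¬ ∃ x y : ℤ, x ^ 2 - 4 * t * y ^ 2 = 5) :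
    ¬ ∃ x y z w : ℤ,
      (0 ≤ 6 * t * x + 3 * t * y + z + 10 * w ∧
       6 * t * x + 3 * t * y + z + 10 * w ≤ 6 * t * b ^ 2 - 2 * a ^ 2 ∧
       0 ≤ 2 * t * x + t * y + z + 10 * w ∧
       2 * t * x + t * y + z + 10 * w ≤ 2 ∧
       0 < (4 * t + 8 * t ^ 2 * b ^ 2) * x + (2 * t + 4 * t ^ 2 * b ^ 2 - 4 * a * b * t) * y
         + (1 + t * b ^ 2) * z + 20 * w ∧
       (4 * t + 8 * t ^ 2 * b ^ 2) * x + (2 * t + 4 * t ^ 2 * b ^ 2 - 4 * a * b * t) * y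
         + (1 + t * b ^ 2) * z + 20 * w < 12 ∧
       8 * t * (2 * a * b) * x + 4 * (t * (2 * a * b) - (a ^ 2 + t * b ^ 2)) * y
         + (2 * a * b) * z = 0) := by
  rintro ⟨x, y, z, w, h1, h2, h3, h4, h5, h6, h7⟩
  obtain ⟨u, hu⟩ : ∃ u, u = 2 * x + y := ⟨_, rfl⟩
  obtain ⟨e, he⟩ : ∃ e, e = 2 * t * x + t * y + z + 10 * w := ⟨_, rfl⟩
  rw [← he] at h3 h4
  have hab : a * b ≠ 0 := by positivity
  -- The invariance equation forces `a * b ∣ 2 * y`.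
  have hinv : a * b * (4 * t * u + z) = (2 * a ^ 2 + 1) * (2 * y) := by
    subst hu
    apply mul_left_cancel₀ (two_ne_zero' ℤ)
    linear_combination h7 - 4 * y * hPell
  obtain ⟨k, hk⟩ : a * b ∣ 2 * y :=
    (isCoprime_mul_of_negPell hPell).dvd_of_dvd_mul_left ⟨_, hinv.symm⟩
  have hz : z = (2 * a ^ 2 + 1) * k - 4 * t * u := by
    have : 4 * t * u + z = (2 * a ^ 2 + 1) * k := by
      apply mul_left_cancel₀ hab
      rw [hinv, hk]
      ring
    linarith
  -- The three effectivity conditions in terms of `u`, `k` and `e`.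
  obtain ⟨m, hm⟩ : ∃ m, m = 4 * t * u - a ^ 2 * k := ⟨_, rfl⟩
  have hD : (4 * t + 8 * t ^ 2 * b ^ 2) * x + (2 * t + 4 * t ^ 2 * b ^ 2 - 4 * a * b * t) * y
      + (1 + t * b ^ 2) * z + 20 * w = m + 2 * e := by
    have hT : t * b ^ 2 = a ^ 2 + 1 := by linarith
    subst hm he hu
    linear_combination (4 * t * (2 * x + y) + z - 2 * a ^ 2 * k) * hT - 2 * a * b * t * hk
      + a ^ 2 * hz
  rw [hD] at h5 h6
  have hw : 10 * w = e + 3 * (t * u) - (2 * a ^ 2 + 1) * k := by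
    subst he hu
    linear_combination -hz
  have hL : 6 * t * x + 3 * t * y + z + 10 * w = 2 * (t * u) + e := by
    subst he hu
    ring
  rw [hL] at h1 h2
  have hu0 : 0 ≤ u := by nlinarith
  have hu1 : t * u ≤ 2 * a ^ 2 + 3 := by nlinarith
  have ha9 : 9 ≤ a ^ 2 := by nlinarith
  have hk0 : -1 ≤ k := by nlinarith
  have hk1 : k ≤ 9 := by nlinarith
  have hj : t * (4 * u - b ^ 2 * k) = m - k := by
    subst hm
    linear_combination k * hPell
  rcases eq_zero_or_of_negPell_minimal (j := 4 * u - b ^ 2 * k) ht ha3 hb hPell hmin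
    (by omega) (by omega) with hj0 | ⟨rfl, rfl, rfl⟩
  · have hmk : m = k := by
      rw [hj0] at hj
      linarith
    have hodd : Odd b := odd_of_negPell hPell
    have h4k : (4 : ℤ) ∣ k := by
      have hcop : IsCoprime (4 : ℤ) (b ^ 2) := by
        obtain ⟨s, hs⟩ := hodd
        have h2 : IsCoprime (2 : ℤ) b := ⟨-s, 1, by linarith⟩
        simpa using (h2.pow : IsCoprime ((2 : ℤ) ^ 2) (b ^ 2))
      exact hcop.dvd_of_dvd_mul_left ⟨u, by linarith⟩
    obtain rfl | rfl | rfl : k = 0 ∨ k = 4 ∨ k = 8 := by omega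
    · obtain rfl : u = 0 := by omega
      omega
    · have hub : u = b ^ 2 := by omega
      have hub_odd : Odd u := hub ▸ hodd.pow
      obtain ⟨r, hr⟩ := hub_odd
      have hy : y = 2 * (a * b) := by linarith
      omega
    · have htu : t * u = 2 * a ^ 2 + 2 := by
        obtain rfl : u = 2 * b ^ 2 := by omega
        linear_combination (-2) * hPell
      omega
  · norm_num at hk hw hm
    have hu2 : u ≤ 2 := by omega
    interval_cases u <;> interval_cases k <;> omega
end
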